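/- (Finite-field Saalschütz formula.) Let α, β, γ, ρ, τ be multiplicative characters of κ with αβγ = ρτ, and suppose the multiset {α,β,γ} is not equal to the multiset {ε,ρ,τ}. Then F(α,β,γ; ρ,τ; 1) = [g°(ρ)·g(ατ̄)·g(βτ̄)·g(γτ̄)] / [g(τ̄)·g°(ᾱρ)·g°(β̄ρ)·g°(γ̄ρ)] + [g°(ρ)·g°(τ)] / [g(α)·g(β)·g(γ)]. -/

import Mathlib

/-!
Finite-field hypergeometric functions (Otsubo), basic definitions:
`κ` is a finite field with `q = Fintype.card κ` elements, `ψ` a fixed nontrivial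
additive character, multiplicative characters are `MulChar κ ℂ` (extended by `0`
on `0`, with trivial character `1`).
-/

open scoped Classical

noncomputable section

variable {κ : Type*} [Field κ] [Fintype κ]

instance : Fintype (MulChar κ ℂ) := Fintype.ofFinite _

/-- The Gauss sum `g(φ) = -∑_{x ∈ κ} ψ(x) φ(x)`. -/
def gS (ψ : AddChar κ ℂ) (φ : MulChar κ ℂ) : ℂ := -∑ x : κ, ψ x * φ x

/-- The variant `g°(φ) = q^{δ(φ)} · g(φ)`, where `δ(φ) = 1` iff `φ` is trivial. -/
def gSo (ψ : AddChar κ ℂ) (φ : MulChar κ ℂ) : ℂ :=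
  (if φ = 1 then (Fintype.card κ : ℂ) else 1) * gS ψ φ

/-- The Pochhammer symbol `(α)_ν = g(αν)/g(α)`. -/
def poch (ψ : AddChar κ ℂ) (α ν : MulChar κ ℂ) : ℂ := gS ψ (α * ν) / gS ψ α

/-- The variant Pochhammer symbol `(α)°_ν = g°(αν)/g°(α)`. -/
def pocho (ψ : AddChar κ ℂ) (α ν : MulChar κ ℂ) : ℂ := gSo ψ (α * ν) / gSo ψ α

/-- The finite hypergeometric function
`F(α₁,…,α_r; β₁,…,β_s; λ) = (1/(1-q)) ∑_ν ((α₁)_ν ⋯ (α_r)_ν / ((ε)°_ν (β₁)°_ν ⋯ (β_s)°_ν)) ν(λ)`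
(the trivial character `ε = 1` appears implicitly among the lower parameters). -/
def Fh (ψ : AddChar κ ℂ) {r s : ℕ} (A : Fin r → MulChar κ ℂ) (B : Fin s → MulChar κ ℂ)
    (l : κ) : ℂ :=
  (1 - (Fintype.card κ : ℂ))⁻¹ *
    ∑ ν : MulChar κ ℂ,
      ((∏ i, poch ψ (A i) ν) / (pocho ψ 1 ν * ∏ j, pocho ψ (B j) ν)) * ν l

lemma gS_eq_neg_gaussSum (ψ : AddChar κ ℂ) (χ : MulChar κ ℂ) : gS ψ χ = -gaussSum χ ψ := by
  simp only [gS, gaussSum, mul_comm]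

lemma gS_one {ψ : AddChar κ ℂ} (hψ : ψ ≠ 1) : gS ψ 1 = 1 := by
  rw [gS_eq_neg_gaussSum, gaussSum_one_left hψ, neg_neg]

lemma card_ne_zero_complex : (Fintype.card κ : ℂ) ≠ 0 :=
  Nat.cast_ne_zero.mpr Fintype.card_ne_zero

lemma MulChar.apply_neg_one_sq (χ : MulChar κ ℂ) : χ (-1) ^ 2 = 1 := by
  rw [← map_pow, neg_one_sq, map_one]

lemma MulChar.map_inv_eq_inv (χ : MulChar κ ℂ) (x : κ) : χ x⁻¹ = (χ x)⁻¹ := by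
  rw [← MulChar.inv_apply', MulChar.inv_apply_eq_inv']

lemma MulChar.inv_apply_neg_one (χ : MulChar κ ℂ) : χ⁻¹ (-1) = χ (-1) := by
  rw [MulChar.inv_apply', inv_neg_one]

lemma gSo_one {ψ : AddChar κ ℂ} (hψ : ψ ≠ 1) : gSo ψ 1 = Fintype.card κ := by
  simp [gSo, gS_one hψ]

lemma gSo_of_ne_one (ψ : AddChar κ ℂ) {χ : MulChar κ ℂ} (hχ : χ ≠ 1) : gSo ψ χ = gS ψ χ := by
  simp [gSo, hχ]

/-- The reflection formula for Gauss sums. -/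
lemma gSo_mul_gS_inv {ψ : AddChar κ ℂ} (hψ : ψ ≠ 1) (χ : MulChar κ ℂ) :
    gSo ψ χ * gS ψ χ⁻¹ = χ (-1) * Fintype.card κ := by
  by_cases hχ : χ = 1
  · subst hχ
    rw [gSo_one hψ, inv_one, gS_one hψ, MulChar.one_apply isUnit_one.neg]
    ring
  · rw [gSo_of_ne_one ψ hχ, gS_eq_neg_gaussSum, gS_eq_neg_gaussSum, neg_mul_neg,
      ← mul_gaussSum_inv_eq_gaussSum χ⁻¹, mul_left_comm,
      gaussSum_mul_gaussSum_eq_card hχ (AddChar.IsPrimitive.of_ne_one hψ),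
      MulChar.inv_apply_neg_one]

lemma gSo_ne_zero {ψ : AddChar κ ℂ} (hψ : ψ ≠ 1) (χ : MulChar κ ℂ) : gSo ψ χ ≠ 0 := by
  refine left_ne_zero_of_mul (b := gS ψ χ⁻¹) ?_
  rw [gSo_mul_gS_inv hψ]
  exact mul_ne_zero (MulChar.apply_ne_zero_iff.mpr isUnit_one.neg) card_ne_zero_complex

lemma gS_ne_zero {ψ : AddChar κ ℂ} (hψ : ψ ≠ 1) (χ : MulChar κ ℂ) : gS ψ χ ≠ 0 :=
  right_ne_zero_of_mul (gSo_ne_zero hψ χ)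

lemma inv_gSo {ψ : AddChar κ ℂ} (hψ : ψ ≠ 1) (χ : MulChar κ ℂ) :
    (gSo ψ χ)⁻¹ = χ (-1) * gS ψ χ⁻¹ / Fintype.card κ := by
  have h := gSo_mul_gS_inv hψ χ
  have hq := card_ne_zero_complex (κ := κ)
  rw [inv_eq_iff_eq_inv, eq_comm, inv_eq_iff_eq_inv, eq_comm]
  refine inv_eq_of_mul_eq_one_right ?_
  field_simp
  linear_combination χ (-1) * h + Fintype.card κ * MulChar.apply_neg_one_sq χ

lemma jacobiSum_eq_gS {ψ : AddChar κ ℂ} (hψ : ψ ≠ 1) {χ φ : MulChar κ ℂ}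
    (h : ¬(χ = 1 ∧ φ = 1)) :
    jacobiSum χ φ = -(gS ψ χ * gS ψ φ / gSo ψ (χ * φ)) := by
  by_cases hχφ : χ * φ = 1
  · obtain rfl : φ = χ⁻¹ := eq_inv_of_mul_eq_one_right hχφ
    have hχ : χ ≠ 1 := fun hχ ↦ h ⟨hχ, by rw [hχ, inv_one]⟩
    rw [jacobiSum_nontrivial_inv hχ, hχφ, gSo_one hψ, ← gSo_of_ne_one ψ hχ,
      gSo_mul_gS_inv hψ, mul_div_cancel_right₀ _ card_ne_zero_complex]
  · rw [gSo_of_ne_one ψ hχφ, jacobiSum_eq_gaussSum_mul_gaussSum_div_gaussSum card_ne_zero_complex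
      hχφ (AddChar.IsPrimitive.of_ne_one hψ)]
    simp only [gS_eq_neg_gaussSum]
    rw [neg_mul_neg, div_neg, neg_neg]

/-- A product of two Gauss sums as a Mellin transform. -/
lemma gS_mul_gS {ψ : AddChar κ ℂ} (hψ : ψ ≠ 1) (χ φ : MulChar κ ℂ) :
    gS ψ χ * gS ψ φ = χ (-1) * ((if χ * φ = 1 then (Fintype.card κ : ℂ) - 1 else 0)
      - gS ψ (χ * φ) * jacobiSum χ (χ * φ)⁻¹) := by
  by_cases h : χ * φ = 1
  · rw [if_pos h, h, gS_one hψ, inv_one, one_mul]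
    obtain rfl : φ = χ⁻¹ := eq_inv_of_mul_eq_one_right h
    by_cases hχ : χ = 1
    · subst hχ
      rw [inv_one, gS_one hψ, jacobiSum_one_one, MulChar.one_apply isUnit_one.neg]
      ring
    · rw [jacobiSum_comm, jacobiSum_one_nontrivial hχ, ← gSo_of_ne_one ψ hχ, gSo_mul_gS_inv hψ]
      ring
  · have h' : ¬(χ = 1 ∧ (χ * φ)⁻¹ = 1) := fun H ↦ h (inv_eq_one.mp H.2)
    have hφ : χ * (χ * φ)⁻¹ = φ⁻¹ := by rw [mul_inv, mul_inv_cancel_left]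
    have h1 := gSo_mul_gS_inv hψ (χ * φ)
    rw [gSo_of_ne_one ψ h, MulChar.mul_apply] at h1
    have h2 := inv_gSo hψ φ⁻¹
    rw [inv_inv, MulChar.inv_apply_neg_one] at h2
    have hq := card_ne_zero_complex (κ := κ)
    rw [if_neg h, jacobiSum_eq_gS hψ h', hφ, div_eq_mul_inv _ (gSo ψ φ⁻¹), h2]
    field_simp
    linear_combination (-gS ψ χ * gS ψ φ * χ (-1) * φ (-1)) * h1
      - gS ψ χ * gS ψ φ * Fintype.card κ * χ (-1) ^ 2 * MulChar.apply_neg_one_sq φ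
      - gS ψ χ * gS ψ φ * Fintype.card κ * MulChar.apply_neg_one_sq χ

/-- Orthogonality of multiplicative characters. -/
lemma sum_mulChar_apply (x : κ) :
    ∑ ν : MulChar κ ℂ, ν x = if x = 1 then (Fintype.card κ : ℂ) - 1 else 0 := by
  split_ifs with hx
  · subst hx
    have h := MulChar.card_eq_card_units_of_hasEnoughRootsOfUnity κ ℂ
    rw [Nat.card_eq_fintype_card, Nat.card_eq_fintype_card] at h
    simp [h, Fintype.card_eq_card_units_add_one (α := κ)]
  · obtain ⟨χ, hχ⟩ := MulChar.exists_apply_ne_one_of_hasEnoughRootsOfUnity κ ℂ hx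
    refine eq_zero_of_mul_eq_self_left hχ ?_
    simp only [Finset.mul_sum, ← MulChar.mul_apply]
    exact Fintype.sum_bijective _ (Group.mulLeft_bijective χ) _ _ fun _ ↦ rfl

/-- The Mellin convolution of two functions supported away from zero. -/
lemma sum_mulChar_prod_two (f g : κ → ℂ) (hg : g 0 = 0) :
    ∑ ν : MulChar κ ℂ, (∑ x, ν x * f x) * (∑ y, ν y * g y) =
      ((Fintype.card κ : ℂ) - 1) * ∑ x, f x * g x⁻¹ := by
  simp only [Finset.sum_mul_sum]
  rw [Finset.sum_comm, Finset.mul_sum]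
  refine Finset.sum_congr rfl fun x _ ↦ ?_
  rw [Finset.sum_comm]
  have h (y : κ) : ∑ ν : MulChar κ ℂ, ν x * f x * (ν y * g y) =
      if x * y = 1 then ((Fintype.card κ : ℂ) - 1) * (f x * g y) else 0 := by
    calc _ = (∑ ν : MulChar κ ℂ, ν (x * y)) * (f x * g y) := by
          rw [Finset.sum_mul]
          refine Finset.sum_congr rfl fun ν _ ↦ ?_
          rw [map_mul]; ring
      _ = _ := by rw [sum_mulChar_apply, ite_mul, zero_mul]
  simp only [h]
  by_cases hx : x = 0
  · simp [hx, hg]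
  · simp [← eq_inv_mul_iff_mul_eq₀ hx]

/-- The Mellin convolution of three functions supported away from zero. -/
lemma sum_mulChar_prod_three (f g h : κ → ℂ) (hh : h 0 = 0) :
    ∑ ν : MulChar κ ℂ, (∑ x, ν x * f x) * (∑ y, ν y * g y) * (∑ z, ν z * h z) =
      ((Fintype.card κ : ℂ) - 1) * ∑ x, ∑ y, f x * g y * h (x * y)⁻¹ := by
  calc _ = ∑ x, ∑ y, ∑ z, (∑ ν : MulChar κ ℂ, ν (x * y * z)) * (f x * g y * h z) := by
        have hν (ν : MulChar κ ℂ) :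
            (∑ x, ν x * f x) * (∑ y, ν y * g y) * (∑ z, ν z * h z) =
              ∑ x, ∑ y, ∑ z, ν (x * y * z) * (f x * g y * h z) := by
          rw [Finset.sum_mul_sum, Finset.sum_mul]
          refine Finset.sum_congr rfl fun x _ ↦ ?_
          rw [Finset.sum_mul]
          refine Finset.sum_congr rfl fun y _ ↦ ?_
          rw [Finset.mul_sum]
          refine Finset.sum_congr rfl fun z _ ↦ ?_
          rw [map_mul, map_mul]; ring
        rw [Finset.sum_congr rfl fun ν _ ↦ hν ν]
        rw [Finset.sum_comm]
        refine Finset.sum_congr rfl fun x _ ↦ ?_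
        rw [Finset.sum_comm]
        refine Finset.sum_congr rfl fun y _ ↦ ?_
        rw [Finset.sum_comm]
        simp only [Finset.sum_mul]
    _ = _ := by
        simp only [Finset.mul_sum, sum_mulChar_apply]
        refine Finset.sum_congr rfl fun x _ ↦ Finset.sum_congr rfl fun y _ ↦ ?_
        by_cases hxy : x * y = 0
        · simp [hxy, hh]
        · simp only [← eq_inv_mul_iff_mul_eq₀ hxy, mul_one, ite_mul, zero_mul,
            Finset.sum_ite_eq', Finset.mem_univ, if_true]

lemma jacobiSum_mul_left (a ν A : MulChar κ ℂ) :
    jacobiSum (a * ν) A = ∑ x, ν x * (a x * A (1 - x)) := by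
  simp only [jacobiSum, MulChar.mul_apply]
  exact Finset.sum_congr rfl fun x _ ↦ by ring

lemma sum_jacobiSum_mul_jacobiSum (b c B : MulChar κ ℂ) :
    ∑ ν, jacobiSum (b * ν) B * jacobiSum (c * ν) B⁻¹ =
      ((Fintype.card κ : ℂ) - 1) *
        (B (-1) * ((if b * c⁻¹ * B = 1 then (Fintype.card κ : ℂ) - 1 else 0) - 1)) := by
  simp only [jacobiSum_mul_left]
  rw [sum_mulChar_prod_two _ _ (by rw [MulChar.map_zero, zero_mul])]
  congr 1
  have h (x : κ) : b x * B (1 - x) * (c x⁻¹ * B⁻¹ (1 - x⁻¹)) =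
      B (-1) * ((b * c⁻¹ * B) x - if x = 1 then 1 else 0) := by
    by_cases hx : x = 0
    · simp only [hx, MulChar.map_zero, zero_mul, zero_ne_one, if_false, sub_zero, mul_zero]
    by_cases hx1 : x = 1
    · simp [hx1, MulChar.map_zero, MulChar.mul_apply, MulChar.inv_apply']
    have h1 : B (1 - x) ≠ 0 :=
      MulChar.apply_ne_zero_iff.mpr (sub_ne_zero.mpr (Ne.symm hx1)).isUnit
    have h2 : 1 - x⁻¹ = -1 * (1 - x) * x⁻¹ := by field_simp; ring
    simp only [hx1, h2, MulChar.mul_apply, MulChar.inv_apply', inv_inv, map_mul,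
      inv_neg_one, if_false]
    rw [MulChar.map_inv_eq_inv B (1 - x)]
    field_simp
    ring
  simp only [h, ← Finset.mul_sum, Finset.sum_sub_distrib, Finset.sum_ite_eq', Finset.mem_univ,
    if_true]
  congr 2
  split_ifs with hc
  · rw [hc, MulChar.sum_one_eq_card_units, Fintype.card_eq_card_units_add_one (α := κ)]
    simp
  · exact MulChar.sum_eq_zero_of_ne_one hc

/-- The substitution `u = (1 - x) / (1 - x y)`, `v = (1 - y) / (1 - x y)` in a double sum. -/
lemma sum_sum_mulChar_eq_jacobiSum (a b c A B : MulChar κ ℂ) :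
    ∑ x, ∑ y, a x * A (1 - x) * (b y * B (1 - y)) *
        (c (x * y)⁻¹ * (A * B)⁻¹ (1 - (x * y)⁻¹)) =
      (A * B) (-1) * (jacobiSum (c * b⁻¹ * B⁻¹) (a * c⁻¹ * A * B) *
        jacobiSum (c * a⁻¹ * A⁻¹) (b * c⁻¹ * A * B) - jacobiSum A B) := by
  set M := c * b⁻¹ * B⁻¹ with hM
  set P := a * c⁻¹ * A * B with hP
  set N := c * a⁻¹ * A⁻¹ with hN
  set R := b * c⁻¹ * A * B with hR
  have hMR : M * R = A := by
    calc M * R = A * (c * c⁻¹) * (b * b⁻¹) * (B * B⁻¹) := by rw [hM, hR]; ac_rfl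
      _ = A := by simp only [mul_inv_cancel, mul_one]
  have hPN : P * N = B := by
    calc P * N = B * (c * c⁻¹) * (a * a⁻¹) * (A * A⁻¹) := by rw [hP, hN]; ac_rfl
      _ = B := by simp only [mul_inv_cancel, mul_one]
  have hJ : ∑ p : κ × κ with p.1 + p.2 = 1, M p.1 * P (1 - p.1) * (N p.2 * R (1 - p.2)) =
      jacobiSum A B := by
    simp only [Finset.sum_filter, Fintype.sum_prod_type, ← eq_sub_iff_add_eq', Finset.sum_ite_eq',
      Finset.mem_univ, if_true, sub_sub_cancel]
    rw [← hMR, ← hPN, jacobiSum]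
    refine Finset.sum_congr rfl fun x _ ↦ ?_
    simp only [MulChar.mul_apply]
    ring
  have hT : jacobiSum M P * jacobiSum N R - jacobiSum A B =
      ∑ p : κ × κ with p.1 + p.2 ≠ 1, M p.1 * P (1 - p.1) * (N p.2 * R (1 - p.2)) := by
    rw [← hJ, sub_eq_iff_eq_add', Finset.sum_filter_add_sum_filter_not, jacobiSum, jacobiSum,
      Finset.sum_mul_sum, Fintype.sum_prod_type]
  set D₁ : Finset (κ × κ) := {p | (p.1 ≠ 0 ∧ p.1 ≠ 1) ∧ (p.2 ≠ 0 ∧ p.2 ≠ 1) ∧ p.1 * p.2 ≠ 1}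
    with hD₁
  set D₂ : Finset (κ × κ) := {p | (p.1 ≠ 0 ∧ p.1 ≠ 1) ∧ (p.2 ≠ 0 ∧ p.2 ≠ 1) ∧ p.1 + p.2 ≠ 1}
    with hD₂
  rw [hT, ← Fintype.sum_prod_type', Finset.mul_sum]
  have hne {x : κ} (hx : x ≠ 1) : 1 - x ≠ 0 := sub_ne_zero.mpr hx.symm
  have h_sub {x y : κ} (h : 1 - x * y ≠ 0) :
      1 - (1 - x) / (1 - x * y) = x * (1 - y) / (1 - x * y) := by
    rw [eq_div_iff h, sub_mul, div_mul_cancel₀ _ h]; ring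
  have h_sub' {x y : κ} (h : 1 - x * y ≠ 0) :
      1 - (1 - y) / (1 - x * y) = y * (1 - x) / (1 - x * y) := by
    rw [eq_div_iff h, sub_mul, div_mul_cancel₀ _ h]; ring
  have h₁ : D₁ ⊆ Finset.univ := Finset.subset_univ _
  have h₂ : D₂ ⊆ ({p | p.1 + p.2 ≠ 1} : Finset (κ × κ)) := by
    intro p hp
    simp only [hD₂, Finset.mem_filter, Finset.mem_univ, true_and] at hp ⊢
    exact hp.2.2
  rw [← Finset.sum_subset h₁, ← Finset.sum_subset h₂]
  · refine Finset.sum_nbij' (fun p ↦ ((1 - p.1) / (1 - p.1 * p.2), (1 - p.2) / (1 - p.1 * p.2)))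
      (fun p ↦ ((1 - p.1) / p.2, (1 - p.2) / p.1)) ?_ ?_ ?_ ?_ ?_
    · rintro ⟨x, y⟩ hp
      simp only [hD₁, hD₂, Finset.mem_filter, Finset.mem_univ, true_and] at hp ⊢
      obtain ⟨⟨hx0, hx1⟩, ⟨hy0, hy1⟩, hxy⟩ := hp
      have hx := hne hx1
      have hy := hne hy1
      have hw := hne hxy
      refine ⟨⟨div_ne_zero hx hw, fun h ↦ ?_⟩, ⟨div_ne_zero hy hw, fun h ↦ ?_⟩, fun h ↦ ?_⟩
      · have := h_sub hw
        rw [h, sub_self] at this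
        exact div_ne_zero (mul_ne_zero hx0 hy) hw this.symm
      · have := h_sub' hw
        rw [h, sub_self] at this
        exact div_ne_zero (mul_ne_zero hy0 hx) hw this.symm
      · rw [← add_div, div_eq_one_iff_eq hw] at h
        exact mul_ne_zero hx hy (by linear_combination h)
    · rintro ⟨u, v⟩ hp
      simp only [hD₁, hD₂, Finset.mem_filter, Finset.mem_univ, true_and] at hp ⊢
      obtain ⟨⟨hu0, hu1⟩, ⟨hv0, hv1⟩, huv⟩ := hp
      refine ⟨⟨div_ne_zero (hne hu1) hv0, fun h ↦ huv ?_⟩,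
        ⟨div_ne_zero (hne hv1) hu0, fun h ↦ huv ?_⟩, fun h ↦ huv ?_⟩
      · rw [div_eq_one_iff_eq hv0] at h
        linear_combination -h
      · rw [div_eq_one_iff_eq hu0] at h
        linear_combination -h
      · rw [div_mul_div_comm, div_eq_one_iff_eq (mul_ne_zero hv0 hu0)] at h
        linear_combination -h
    · rintro ⟨x, y⟩ hp
      simp only [hD₁, Finset.mem_filter, Finset.mem_univ, true_and] at hp
      obtain ⟨⟨hx0, hx1⟩, ⟨hy0, hy1⟩, hxy⟩ := hp
      have hw := hne hxy
      simp only [Prod.mk.injEq]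
      rw [h_sub hw, h_sub' hw, div_div_div_cancel_right₀ hw, div_div_div_cancel_right₀ hw,
        mul_div_cancel_right₀ _ (hne hx1), mul_div_cancel_right₀ _ (hne hy1)]
      exact ⟨rfl, rfl⟩
    · rintro ⟨u, v⟩ hp
      simp only [hD₂, Finset.mem_filter, Finset.mem_univ, true_and] at hp
      obtain ⟨⟨hu0, hu1⟩, ⟨hv0, hv1⟩, huv⟩ := hp
      have hw : u + v - 1 ≠ 0 := sub_ne_zero.mpr huv
      have h1 : 1 - (1 - u) / v * ((1 - v) / u) = (u + v - 1) / (u * v) := by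
        field_simp; ring
      have h2 : 1 - (1 - u) / v = (u + v - 1) / v := by field_simp; ring
      have h3 : 1 - (1 - v) / u = (u + v - 1) / u := by field_simp; ring
      simp only [Prod.mk.injEq, h1, h2, h3]
      constructor <;> field_simp
    · rintro ⟨x, y⟩ hp
      simp only [hD₁, Finset.mem_filter, Finset.mem_univ, true_and] at hp
      obtain ⟨⟨hx0, hx1⟩, ⟨hy0, hy1⟩, hxy⟩ := hp
      have hw := hne hxy
      have h1 : 1 - (x * y)⁻¹ = -1 * (1 - x * y) * x⁻¹ * y⁻¹ := by field_simp; ring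
      have hA : (A (-1))⁻¹ = A (-1) := by rw [← MulChar.map_inv_eq_inv, inv_neg_one]
      have hB : (B (-1))⁻¹ = B (-1) := by rw [← MulChar.map_inv_eq_inv, inv_neg_one]
      have h2 : M ((1 - x) / (1 - x * y)) * P (x * (1 - y) / (1 - x * y)) *
          (N ((1 - y) / (1 - x * y)) * R (y * (1 - x) / (1 - x * y))) =
          (M * R) (1 - x) * (P * N) (1 - y) * P x * R y * ((M * R * (P * N)) (1 - x * y))⁻¹ := by
        simp only [MulChar.mul_apply, div_eq_mul_inv, map_mul, MulChar.map_inv_eq_inv]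
        ring
      simp only [h_sub hw, h_sub' hw, h1, h2, hMR, hPN]
      simp only [hP, hR, MulChar.mul_apply, mul_inv, MulChar.inv_apply_eq_inv', map_mul,
        MulChar.map_inv_eq_inv, inv_inv, hA, hB]
      ring
  · rintro ⟨u, v⟩ huv hp
    simp only [hD₂, Finset.mem_filter, Finset.mem_univ, true_and] at huv hp
    by_cases hu0 : u = 0
    · simp [hu0, MulChar.map_zero]
    by_cases hu1 : u = 1
    · simp [hu1, MulChar.map_zero]
    by_cases hv0 : v = 0
    · simp [hv0, MulChar.map_zero]
    by_cases hv1 : v = 1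
    · simp [hv1, MulChar.map_zero]
    exact absurd ⟨⟨hu0, hu1⟩, ⟨hv0, hv1⟩, huv⟩ hp
  · rintro ⟨x, y⟩ - hp
    simp only [hD₁, Finset.mem_filter, Finset.mem_univ, true_and] at hp
    by_cases hx0 : x = 0
    · simp [hx0, MulChar.map_zero]
    by_cases hx1 : x = 1
    · simp [hx1, MulChar.map_zero]
    by_cases hy0 : y = 0
    · simp [hy0, MulChar.map_zero]
    by_cases hy1 : y = 1
    · simp [hy1, MulChar.map_zero]
    have hxy : x * y = 1 := by
      by_contra hxy
      exact hp ⟨⟨hx0, hx1⟩, ⟨hy0, hy1⟩, hxy⟩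
    simp [hxy, MulChar.map_zero]

lemma Multiset.triple_swap {G : Type*} (x y z : G) : ({x, y, z} : Multiset G) = {y, x, z} :=
  Multiset.cons_swap x y {z}

lemma not_mul_eq_one_of_multiset_ne {G : Type*} [CommGroup G] {a b c d e f : G}
    (hprod : a * b * c * (d * e * f) = 1)
    (hms : ({a, b, c} : Multiset G) ≠ {d⁻¹, e⁻¹, f⁻¹}) : ¬(b * e = 1 ∧ c * f = 1) := by
  rintro ⟨h2, h3⟩
  have h1 : a * d = 1 := by
    calc a * d = a * d * ((b * e) * (c * f)) := by rw [h2, h3, mul_one, mul_one]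
      _ = a * b * c * (d * e * f) := by ac_rfl
      _ = 1 := hprod
  rw [eq_inv_of_mul_eq_one_left h1, eq_inv_of_mul_eq_one_left h2,
    eq_inv_of_mul_eq_one_left h3] at hms
  exact hms rfl

lemma sum_gS_prod_six_of_ne_one {ψ : AddChar κ ℂ} (hψ : ψ ≠ 1) {a b c d e f : MulChar κ ℂ}
    (hprod : a * b * c * (d * e * f) = 1) (hms : ({a, b, c} : Multiset _) ≠ {d⁻¹, e⁻¹, f⁻¹})
    (hbe : b * e ≠ 1) (hcf : c * f ≠ 1) :
    ∑ ν : MulChar κ ℂ, ν (-1) * (gS ψ (a * ν) * gS ψ (b * ν) * gS ψ (c * ν)) *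
        (gS ψ (d * ν⁻¹) * gS ψ (e * ν⁻¹) * gS ψ (f * ν⁻¹)) =
      (1 - (Fintype.card κ : ℂ)) * (a * b * c) (-1) *
        ((gS ψ (a * d) * gS ψ (a * e) * gS ψ (a * f)) *
          (gS ψ (b * d) * gS ψ (b * e) * gS ψ (b * f)) *
          (gS ψ (c * d) * gS ψ (c * e) * gS ψ (c * f)) / (Fintype.card κ : ℂ) ^ 2 +
        (Fintype.card κ : ℂ) ^ 2) := by
  have h_id {χ φ : MulChar κ ℂ} (h : χ * φ = a * b * c * (d * e * f)) : χ * φ = 1 := h.trans hprod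
  have hC : (c * f)⁻¹ = ((a * d)⁻¹ * (b * e)⁻¹)⁻¹ := by
    rw [← mul_inv, inv_inv]
    exact inv_eq_of_mul_eq_one_right (h_id (by ac_rfl))
  have h_right (χ : MulChar κ ℂ) : χ * c⁻¹ * (a * d)⁻¹ * (b * e)⁻¹ = χ * f := by
    rw [mul_assoc _ (a * d)⁻¹, ← inv_inj.mp hC, mul_assoc, inv_mul_cancel_left]
  have h_left (χ φ : MulChar κ ℂ) : c * χ⁻¹ * (χ * φ)⁻¹⁻¹ = c * φ := by
    rw [inv_inv, mul_assoc, inv_mul_cancel_left]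
  have h_term (ν : MulChar κ ℂ) :
      ν (-1) * (gS ψ (a * ν) * gS ψ (b * ν) * gS ψ (c * ν)) *
        (gS ψ (d * ν⁻¹) * gS ψ (e * ν⁻¹) * gS ψ (f * ν⁻¹)) =
      (a * b * c) (-1) * (gS ψ (b * e) * gS ψ (c * f)) *
        ((if a * d = 1 then (Fintype.card κ : ℂ) - 1 else 0) *
          (jacobiSum (b * ν) (b * e)⁻¹ * jacobiSum (c * ν) (c * f)⁻¹) -
        gS ψ (a * d) * (jacobiSum (a * ν) (a * d)⁻¹ * jacobiSum (b * ν) (b * e)⁻¹ *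
          jacobiSum (c * ν) (c * f)⁻¹)) := by
    have h_mul (χ φ : MulChar κ ℂ) : χ * ν * (φ * ν⁻¹) = χ * φ := by
      rw [mul_mul_mul_comm, mul_inv_cancel, mul_one]
    have h1 := gS_mul_gS hψ (a * ν) (d * ν⁻¹)
    have h2 := gS_mul_gS hψ (b * ν) (e * ν⁻¹)
    have h3 := gS_mul_gS hψ (c * ν) (f * ν⁻¹)
    rw [h_mul] at h1 h2 h3
    rw [if_neg hbe] at h2
    rw [if_neg hcf] at h3
    calc _ = ν (-1) * (gS ψ (a * ν) * gS ψ (d * ν⁻¹)) * (gS ψ (b * ν) * gS ψ (e * ν⁻¹)) *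
          (gS ψ (c * ν) * gS ψ (f * ν⁻¹)) := by ring
      _ = (ν (-1) ^ 2) ^ 2 * ((a * b * c) (-1) * (gS ψ (b * e) * gS ψ (c * f)) *
          ((if a * d = 1 then (Fintype.card κ : ℂ) - 1 else 0) *
            (jacobiSum (b * ν) (b * e)⁻¹ * jacobiSum (c * ν) (c * f)⁻¹) -
          gS ψ (a * d) * (jacobiSum (a * ν) (a * d)⁻¹ * jacobiSum (b * ν) (b * e)⁻¹ *
            jacobiSum (c * ν) (c * f)⁻¹))) := by
        rw [h1, h2, h3]
        simp only [MulChar.mul_apply]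
        ring
      _ = _ := by rw [MulChar.apply_neg_one_sq, one_pow, one_mul]
  have h_three : ∑ ν, jacobiSum (a * ν) (a * d)⁻¹ * jacobiSum (b * ν) (b * e)⁻¹ *
      jacobiSum (c * ν) (c * f)⁻¹ = ((Fintype.card κ : ℂ) - 1) * ((c * f) (-1) *
        (jacobiSum (c * e) (a * f) * jacobiSum (c * d) (b * f) -
          jacobiSum (a * d)⁻¹ (b * e)⁻¹)) := by
    rw [Finset.sum_congr rfl fun ν _ ↦ by
      rw [jacobiSum_mul_left, jacobiSum_mul_left, jacobiSum_mul_left c ν]]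
    rw [sum_mulChar_prod_three _ _ _ (by rw [MulChar.map_zero, zero_mul]), hC,
      sum_sum_mulChar_eq_jacobiSum, h_right, h_right, h_left, h_left, ← MulChar.inv_apply_neg_one,
      ← hC, MulChar.inv_apply_neg_one]
  have hms₁ : ¬(c * e = 1 ∧ a * f = 1) := fun h ↦
    not_mul_eq_one_of_multiset_ne (a := b) (d := d) (h_id (by ac_rfl))
      (by rwa [Multiset.pair_comm c, Multiset.triple_swap b]) h
  have hms₂ : ¬(c * d = 1 ∧ b * f = 1) := fun h ↦
    not_mul_eq_one_of_multiset_ne (a := a) (d := e) (h_id (by ac_rfl))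
      (by rwa [Multiset.pair_comm c, Multiset.triple_swap e⁻¹]) h
  have hms₃ : ¬((a * d)⁻¹ = 1 ∧ (b * e)⁻¹ = 1) := fun h ↦ hbe (inv_eq_one.mp h.2)
  have h_two : (if a * d = 1 then (Fintype.card κ : ℂ) - 1 else 0) *
      ∑ ν, jacobiSum (b * ν) (b * e)⁻¹ * jacobiSum (c * ν) (c * f)⁻¹ =
      (if a * d = 1 then (Fintype.card κ : ℂ) - 1 else 0) *
        -(((Fintype.card κ : ℂ) - 1) * (c * f) (-1)) := by
    split_ifs with had
    · have hcf' : (c * f)⁻¹ = (b * e)⁻¹⁻¹ := by rw [hC, had, inv_one, one_mul]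
      have hne : b * c⁻¹ * (b * e)⁻¹ ≠ 1 := by
        rw [mul_inv, mul_assoc, mul_left_comm c⁻¹, mul_inv_cancel_left, ← mul_inv, inv_ne_one]
        intro hce
        exact not_mul_eq_one_of_multiset_ne (a := b) (d := f) (h_id (by ac_rfl))
          (by rwa [Multiset.triple_swap b, Multiset.triple_swap f⁻¹, Multiset.pair_comm f⁻¹])
            ⟨had, hce⟩
      have hsign : (b * e)⁻¹ (-1) = (c * f) (-1) := by rw [← inv_inj.mp hcf']
      rw [hcf', sum_jacobiSum_mul_jacobiSum, if_neg hne, hsign]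
      ring
    · rw [zero_mul, zero_mul]
  have hprod₁ : c * e * (a * f) = (b * d)⁻¹ := eq_inv_of_mul_eq_one_left (h_id (by ac_rfl))
  have hprod₂ : c * d * (b * f) = (a * e)⁻¹ := eq_inv_of_mul_eq_one_left (h_id (by ac_rfl))
  have hq := card_ne_zero_complex (κ := κ)
  have hsign (χ : MulChar κ ℂ) : χ (-1) ^ 2 = 1 := χ.apply_neg_one_sq
  have hsign₁ : (c * f) (-1) = (a * d) (-1) * (b * e) (-1) := by
    rw [inv_inj.mp hC, MulChar.mul_apply, MulChar.inv_apply_neg_one, MulChar.inv_apply_neg_one]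
  have hsign₂ : (c * f) (-1) * ((b * d) (-1) * (a * e) (-1)) = 1 := by
    rw [← MulChar.mul_apply, ← MulChar.mul_apply, h_id (by ac_rfl),
      MulChar.one_apply isUnit_one.neg]
  have h_jac : gS ψ (b * e) * gS ψ (c * f) * ((if a * d = 1 then (Fintype.card κ : ℂ) - 1 else 0) -
      gS ψ (a * d) * jacobiSum (a * d)⁻¹ (b * e)⁻¹) = (c * f) (-1) * (Fintype.card κ : ℂ) ^ 2 := by
    have hr := gSo_mul_gS_inv hψ (b * e)
    rw [gSo_of_ne_one ψ hbe] at hr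
    by_cases had : a * d = 1
    · rw [if_pos had, had, inv_one, jacobiSum_one_nontrivial (inv_ne_one.mpr hbe), gS_one hψ,
        hsign₁, inv_inj.mp hC, had, inv_one, one_mul, hr, MulChar.one_apply isUnit_one.neg]
      ring
    · have hs := gSo_mul_gS_inv hψ (a * d)
      rw [gSo_of_ne_one ψ had] at hs
      have hcf0 := gS_ne_zero hψ (c * f)
      rw [if_neg had, jacobiSum_eq_gS hψ hms₃, ← inv_inj.mp hC, gSo_of_ne_one ψ hcf, hsign₁]
      field_simp
      linear_combination gS ψ (b * e) * gS ψ (b * e)⁻¹ * hs +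
        (a * d) (-1) * (Fintype.card κ : ℂ) * hr
  rw [Finset.sum_congr rfl fun ν _ ↦ h_term ν, ← Finset.mul_sum, Finset.sum_sub_distrib,
    ← Finset.mul_sum, ← Finset.mul_sum, h_two, h_three, jacobiSum_eq_gS hψ hms₁,
    jacobiSum_eq_gS hψ hms₂, hprod₁, hprod₂, div_eq_mul_inv _ (gSo ψ _),
    div_eq_mul_inv _ (gSo ψ (a * e)⁻¹), inv_gSo hψ, inv_gSo hψ, inv_inv, inv_inv,
    MulChar.inv_apply_neg_one, MulChar.inv_apply_neg_one]
  have h_sq := hsign (c * f)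
  linear_combination (1 - (Fintype.card κ : ℂ)) * (a * b * c) (-1) * ((c * f) (-1) * h_jac +
    (Fintype.card κ : ℂ) ^ 2 * h_sq +
    (gS ψ (a * d) * gS ψ (a * e) * gS ψ (a * f)) * (gS ψ (b * d) * gS ψ (b * e) * gS ψ (b * f)) *
      (gS ψ (c * d) * gS ψ (c * e) * gS ψ (c * f)) / (Fintype.card κ : ℂ) ^ 2 * hsign₂)

/-- The Gauss sum analogue of a balanced Barnes-type integral with three pairs of factors. -/
lemma sum_gS_prod_six {ψ : AddChar κ ℂ} (hψ : ψ ≠ 1) {a b c d e f : MulChar κ ℂ}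
    (hprod : a * b * c * (d * e * f) = 1) (hms : ({a, b, c} : Multiset _) ≠ {d⁻¹, e⁻¹, f⁻¹}) :
    ∑ ν : MulChar κ ℂ, ν (-1) * (gS ψ (a * ν) * gS ψ (b * ν) * gS ψ (c * ν)) *
        (gS ψ (d * ν⁻¹) * gS ψ (e * ν⁻¹) * gS ψ (f * ν⁻¹)) =
      (1 - (Fintype.card κ : ℂ)) * (a * b * c) (-1) *
        ((gS ψ (a * d) * gS ψ (a * e) * gS ψ (a * f)) *
          (gS ψ (b * d) * gS ψ (b * e) * gS ψ (b * f)) *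
          (gS ψ (c * d) * gS ψ (c * e) * gS ψ (c * f)) / (Fintype.card κ : ℂ) ^ 2 +
        (Fintype.card κ : ℂ) ^ 2) := by
  have h_id {χ φ : MulChar κ ℂ} (h : χ * φ = a * b * c * (d * e * f)) : χ * φ = 1 := h.trans hprod
  by_cases hbe : b * e = 1
  · have had : a * d ≠ 1 := fun had ↦ not_mul_eq_one_of_multiset_ne (a := c) (d := f)
      (h_id (by ac_rfl)) (by rwa [Multiset.triple_swap c, Multiset.pair_comm c,
        Multiset.triple_swap f⁻¹, Multiset.pair_comm f⁻¹]) ⟨had, hbe⟩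
    have hcf : c * f ≠ 1 := fun hcf ↦ not_mul_eq_one_of_multiset_ne hprod hms ⟨hbe, hcf⟩
    have h := sum_gS_prod_six_of_ne_one hψ (a := b) (b := a) (c := c) (d := e) (e := d) (f := f)
      (h_id (by ac_rfl)) (by rwa [Multiset.triple_swap b, Multiset.triple_swap e⁻¹]) had hcf
    rw [mul_comm b a] at h
    convert h using 1
    · exact Finset.sum_congr rfl fun ν _ ↦ by ring
    · ring
  by_cases hcf : c * f = 1
  · have had : a * d ≠ 1 := fun had ↦ not_mul_eq_one_of_multiset_ne (a := b) (d := e)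
      (h_id (by ac_rfl)) (by rwa [Multiset.triple_swap b, Multiset.triple_swap e⁻¹]) ⟨had, hcf⟩
    have h := sum_gS_prod_six_of_ne_one hψ (a := c) (b := b) (c := a) (d := f) (e := e) (f := d)
      (h_id (by ac_rfl)) (by rwa [Multiset.pair_comm b, Multiset.triple_swap c,
        Multiset.pair_comm c, Multiset.pair_comm e⁻¹, Multiset.triple_swap f⁻¹,
        Multiset.pair_comm f⁻¹]) hbe had
    rw [show c * b * a = a * b * c by ac_rfl] at h
    convert h using 1
    · exact Finset.sum_congr rfl fun ν _ ↦ by ring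
    · ring
  exact sum_gS_prod_six_of_ne_one hψ hprod hms hbe hcf

lemma inv_pocho {ψ : AddChar κ ℂ} (hψ : ψ ≠ 1) (χ ν : MulChar κ ℂ) :
    (pocho ψ χ ν)⁻¹ = gSo ψ χ * ((χ (-1) * ν (-1)) * gS ψ (χ⁻¹ * ν⁻¹)) / Fintype.card κ := by
  rw [pocho, inv_div, div_eq_mul_inv, inv_gSo hψ, MulChar.mul_apply, mul_inv, ← mul_div_assoc]

lemma inv_pocho_one {ψ : AddChar κ ℂ} (hψ : ψ ≠ 1) (ν : MulChar κ ℂ) :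
    (pocho ψ 1 ν)⁻¹ = ν (-1) * gS ψ (1 * ν⁻¹) := by
  rw [inv_pocho hψ, gSo_one hψ, MulChar.one_apply isUnit_one.neg, inv_one, one_mul (ν (-1)),
    mul_div_cancel_left₀ _ card_ne_zero_complex]

lemma inv_gSo_inv_mul {ψ : AddChar κ ℂ} (hψ : ψ ≠ 1) (χ φ : MulChar κ ℂ) :
    (gSo ψ (χ⁻¹ * φ))⁻¹ = χ (-1) * φ (-1) * gS ψ (χ * φ⁻¹) / Fintype.card κ := by
  rw [inv_gSo hψ, mul_inv, inv_inv, MulChar.mul_apply, MulChar.inv_apply_neg_one]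

lemma inv_gS_inv {ψ : AddChar κ ℂ} (hψ : ψ ≠ 1) (χ : MulChar κ ℂ) :
    (gS ψ χ⁻¹)⁻¹ = χ (-1) * gSo ψ χ / Fintype.card κ := by
  have hq := card_ne_zero_complex (κ := κ)
  have h := gSo_mul_gS_inv hψ χ
  refine inv_eq_of_mul_eq_one_right ?_
  field_simp
  linear_combination χ (-1) * h + Fintype.card κ * MulChar.apply_neg_one_sq χ

lemma Fh_saalschutz_eq_sum {ψ : AddChar κ ℂ} (hψ : ψ ≠ 1) (α β γ ρ τ : MulChar κ ℂ) :
    Fh ψ ![α, β, γ] ![ρ, τ] 1 = (1 - (Fintype.card κ : ℂ))⁻¹ *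
      (gSo ψ ρ * gSo ψ τ / (gS ψ α * gS ψ β * gS ψ γ) * (ρ * τ) (-1) / (Fintype.card κ : ℂ) ^ 2) *
      ∑ ν : MulChar κ ℂ, ν (-1) * (gS ψ (α * ν) * gS ψ (β * ν) * gS ψ (γ * ν)) *
        (gS ψ (1 * ν⁻¹) * gS ψ (ρ⁻¹ * ν⁻¹) * gS ψ (τ⁻¹ * ν⁻¹)) := by
  rw [Fh, mul_assoc (1 - (Fintype.card κ : ℂ))⁻¹]
  congr 1
  rw [Finset.mul_sum]
  refine Finset.sum_congr rfl fun ν _ ↦ ?_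
  simp only [Fin.prod_univ_three, Fin.prod_univ_two, Matrix.cons_val_zero, Matrix.cons_val_one,
    Matrix.cons_val, map_one, mul_one]
  rw [div_eq_mul_inv, mul_inv, mul_inv, inv_pocho_one hψ, inv_pocho hψ, inv_pocho hψ,
    MulChar.mul_apply, poch, poch, poch]
  linear_combination gSo ψ ρ * gSo ψ τ / (gS ψ α * gS ψ β * gS ψ γ) * (ρ (-1) * τ (-1)) /
    (Fintype.card κ : ℂ) ^ 2 * (ν (-1) * (gS ψ (α * ν) * gS ψ (β * ν) * gS ψ (γ * ν)) *
      (gS ψ (1 * ν⁻¹) * gS ψ (ρ⁻¹ * ν⁻¹) * gS ψ (τ⁻¹ * ν⁻¹))) * MulChar.apply_neg_one_sq ν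

/-- finite-field Saalschütz formula: if `αβγ = ρτ` and the multiset
`{α,β,γ}` differs from `{ε,ρ,τ}`, then
`F(α,β,γ;ρ,τ;1) = g°(ρ)g(ατ̄)g(βτ̄)g(γτ̄)/(g(τ̄)g°(ᾱρ)g°(β̄ρ)g°(γ̄ρ)) + g°(ρ)g°(τ)/(g(α)g(β)g(γ))`. -/
theorem stmt_15 (ψ : AddChar κ ℂ) (hψ : ψ ≠ 1) (α β γ ρ τ : MulChar κ ℂ)
    (hprod : α * β * γ = ρ * τ)
    (hms : ({α, β, γ} : Multiset (MulChar κ ℂ)) ≠ {1, ρ, τ}) :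
    Fh ψ ![α, β, γ] ![ρ, τ] 1 =
      gSo ψ ρ * gS ψ (α * τ⁻¹) * gS ψ (β * τ⁻¹) * gS ψ (γ * τ⁻¹) /
          (gS ψ τ⁻¹ * gSo ψ (α⁻¹ * ρ) * gSo ψ (β⁻¹ * ρ) * gSo ψ (γ⁻¹ * ρ)) +
        gSo ψ ρ * gSo ψ τ / (gS ψ α * gS ψ β * gS ψ γ) := by
  have hms' : ({α, β, γ} : Multiset (MulChar κ ℂ)) ≠ {1⁻¹, ρ⁻¹⁻¹, τ⁻¹⁻¹} := by
    rwa [inv_one, inv_inv, inv_inv]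
  have hprod' : α * β * γ * (1 * ρ⁻¹ * τ⁻¹) = 1 := by
    rw [hprod, one_mul, ← mul_inv, mul_inv_cancel]
  rw [Fh_saalschutz_eq_sum hψ, sum_gS_prod_six hψ hprod' hms', hprod]
  have hq := card_ne_zero_complex (κ := κ)
  have hq1 : 1 - (Fintype.card κ : ℂ) ≠ 0 :=
    sub_ne_zero.mpr (Nat.cast_ne_one.mpr Fintype.one_lt_card.ne').symm
  have hα := gS_ne_zero hψ α
  have hβ := gS_ne_zero hψ β
  have hγ := gS_ne_zero hψ γ
  have h_sq : (ρ * τ) (-1) ^ 2 = 1 := MulChar.apply_neg_one_sq _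
  have h_sign : τ (-1) * (α (-1) * β (-1) * γ (-1)) * ρ (-1) ^ 3 = 1 := by
    rw [← MulChar.mul_apply, ← MulChar.mul_apply, hprod, MulChar.mul_apply]
    linear_combination (ρ (-1) ^ 2 + 1) * ρ.apply_neg_one_sq +
      ρ (-1) ^ 4 * τ.apply_neg_one_sq
  calc _ = gSo ψ ρ * gSo ψ τ / (gS ψ α * gS ψ β * gS ψ γ) * (ρ * τ) (-1) ^ 2 *
        (gS ψ α * gS ψ β * gS ψ γ * (gS ψ (α * ρ⁻¹) * gS ψ (β * ρ⁻¹) * gS ψ (γ * ρ⁻¹)) *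
          (gS ψ (α * τ⁻¹) * gS ψ (β * τ⁻¹) * gS ψ (γ * τ⁻¹)) / (Fintype.card κ : ℂ) ^ 4 + 1) := by
        simp only [mul_one]
        field_simp
    _ = gSo ψ ρ * gSo ψ τ * (gS ψ (α * ρ⁻¹) * gS ψ (β * ρ⁻¹) * gS ψ (γ * ρ⁻¹)) *
          (gS ψ (α * τ⁻¹) * gS ψ (β * τ⁻¹) * gS ψ (γ * τ⁻¹)) / (Fintype.card κ : ℂ) ^ 4 +
        gSo ψ ρ * gSo ψ τ / (gS ψ α * gS ψ β * gS ψ γ) := by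
        rw [h_sq]
        field_simp
    _ = _ := by
        rw [div_eq_mul_inv _ (gS ψ τ⁻¹ * _ * _ * _), mul_inv, mul_inv, mul_inv, inv_gS_inv hψ,
          inv_gSo_inv_mul hψ, inv_gSo_inv_mul hψ, inv_gSo_inv_mul hψ]
        linear_combination -(gSo ψ ρ * gSo ψ τ *
          (gS ψ (α * ρ⁻¹) * gS ψ (β * ρ⁻¹) * gS ψ (γ * ρ⁻¹)) *
          (gS ψ (α * τ⁻¹) * gS ψ (β * τ⁻¹) * gS ψ (γ * τ⁻¹)) / (Fintype.card κ : ℂ) ^ 4) * h_sign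

end
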